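/- arXiv:2305.18833 — 2 statements merged into one kernel-verified Lean document; each statement's English description precedes it below -/
import Mathlib

section
/- (Compatibility condition (S₂), Theorem 2.2.) For every integer n ≥ 0 and every z ∈ ℂ with Im z ≠ 0: 1 + (z − α_n)·(B_{n+1}(z) − B_n(z)) = β_{n+1}·A_{n+1}(z) − β_n·A_{n−1}(z), where for n = 0 the last term is interpreted as β_0·A_{−1}(z) = 0. -/
open MeasureTheory Polynomial

/-- A real function dominated by `C * exp (c * |x|)`. -/
def ExpBounded (G : ℝ → ℝ) : Prop :=
  ∃ C c : ℝ, 0 ≤ C ∧ 0 ≤ c ∧ ∀ x, |G x| ≤ C * Real.exp (c * |x|)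

namespace ExpBounded

lemma const (r : ℝ) : ExpBounded fun _ => r :=
  ⟨|r|, 0, abs_nonneg r, le_rfl, fun x => by simp⟩

lemma id : ExpBounded fun x => x :=
  ⟨1, 1, zero_le_one, zero_le_one, fun x => by
    rw [one_mul, one_mul]
    linarith [Real.add_one_le_exp |x|]⟩

lemma mul {F G : ℝ → ℝ} (hF : ExpBounded F) (hG : ExpBounded G) :
    ExpBounded fun x => F x * G x := by
  obtain ⟨C, c, hC, hc, h⟩ := hF
  obtain ⟨D, d, hD, hd, k⟩ := hG
  refine ⟨C * D, c + d, mul_nonneg hC hD, add_nonneg hc hd, fun x => ?_⟩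
  rw [abs_mul, add_mul, Real.exp_add]
  calc |F x| * |G x| ≤ (C * Real.exp (c * |x|)) * (D * Real.exp (d * |x|)) :=
        mul_le_mul (h x) (k x) (abs_nonneg _) (by positivity)
    _ = _ := by ring

lemma add {F G : ℝ → ℝ} (hF : ExpBounded F) (hG : ExpBounded G) :
    ExpBounded fun x => F x + G x := by
  obtain ⟨C, c, hC, hc, h⟩ := hF
  obtain ⟨D, d, hD, hd, k⟩ := hG
  refine ⟨C + D, c + d, add_nonneg hC hD, add_nonneg hc hd, fun x => ?_⟩
  have h1 : Real.exp (c * |x|) ≤ Real.exp ((c + d) * |x|) := by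
    gcongr; linarith
  have h2 : Real.exp (d * |x|) ≤ Real.exp ((c + d) * |x|) := by
    gcongr; linarith
  calc |F x + G x| ≤ |F x| + |G x| := abs_add_le _ _
    _ ≤ C * Real.exp (c * |x|) + D * Real.exp (d * |x|) := add_le_add (h x) (k x)
    _ ≤ C * Real.exp ((c + d) * |x|) + D * Real.exp ((c + d) * |x|) := by gcongr
    _ = _ := by ring

lemma abs_rpow {G : ℝ → ℝ} (hG : ExpBounded G) {s : ℝ} (hs : 0 ≤ s) :
    ExpBounded fun x => |G x| ^ s := by
  obtain ⟨C, c, hC, hc, h⟩ := hG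
  refine ⟨C ^ s, c * s, by positivity, by positivity, fun x => ?_⟩
  rw [abs_of_nonneg (by positivity)]
  calc |G x| ^ s ≤ (C * Real.exp (c * |x|)) ^ s := Real.rpow_le_rpow (abs_nonneg _) (h x) hs
    _ = _ := by
      rw [Real.mul_rpow hC (Real.exp_pos _).le, ← Real.exp_mul]
      ring_nf

lemma eval (p : ℝ[X]) : ExpBounded fun x => p.eval x := by
  induction p using Polynomial.induction_on' with
  | add p q hp hq => simpa using hp.add hq
  | monomial n a =>
    simp only [eval_monomial]
    refine (const a).mul ?_
    induction n with
    | zero => simpa using const 1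
    | succ n ih => simpa only [pow_succ] using ih.mul id

lemma prod_abs_sub_rpow {ι : Type*} (S : Finset ι) (t γ : ι → ℝ) (hγ : ∀ j, 0 < γ j) :
    ExpBounded fun x => ∏ j ∈ S, |x - t j| ^ γ j := by
  classical
  induction S using Finset.induction_on with
  | empty => simpa using const 1
  | insert a S ha ih =>
    simp only [Finset.prod_insert ha]
    refine (abs_rpow ?_ (hγ a).le).mul ih
    simpa only [sub_eq_add_neg] using id.add (const (-t a))

lemma abs_mul_exp_neg_sq_le {G : ℝ → ℝ} (hG : ExpBounded G) (a : ℝ) :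
    ∃ C : ℝ, ∀ x, |G x| * Real.exp (-x ^ 2) ≤ C * Real.exp (-(1 / 2) * (x - a) ^ 2) := by
  obtain ⟨C, c, hC, hc, h⟩ := hG
  refine ⟨C * Real.exp ((c + |a|) ^ 2 / 2 + a ^ 2 / 2), fun x => ?_⟩
  calc |G x| * Real.exp (-x ^ 2) ≤ C * Real.exp (c * |x|) * Real.exp (-x ^ 2) := by
        gcongr; exact h x
    _ = C * Real.exp (c * |x| + -x ^ 2) := by rw [mul_assoc, Real.exp_add]
    _ ≤ C * Real.exp (((c + |a|) ^ 2 / 2 + a ^ 2 / 2) + -(1 / 2) * (x - a) ^ 2) := by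
        refine mul_le_mul_of_nonneg_left (Real.exp_le_exp.2 ?_) hC
        have h1 : -(x * a) ≤ |x| * |a| := by rw [← abs_mul]; exact neg_le_abs _
        nlinarith [sq_nonneg (|x| - (c + |a|)), sq_abs x]
    _ = _ := by rw [Real.exp_add, mul_assoc]

end ExpBounded

lemma integrable_abs_rpow_mul_exp_neg_mul_sq {b : ℝ} (hb : 0 < b) {s : ℝ} (hs : -1 < s) :
    Integrable fun x : ℝ => |x| ^ s * Real.exp (-b * x ^ 2) := by
  have h1 := integrable_rpow_mul_exp_neg_mul_sq hb hs
  have h2 := h1.comp_neg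
  refine (h1.norm.add h2.norm).mono' (by fun_prop) (Filter.Eventually.of_forall fun x => ?_)
  simp only [Pi.add_apply, norm_mul, Real.norm_eq_abs, Real.abs_exp, neg_sq, ← add_mul]
  gcongr
  rw [abs_of_nonneg (by positivity)]
  rcases le_total 0 x with hx | hx
  · rw [abs_of_nonneg hx]
    exact (le_abs_self _).trans (le_add_of_nonneg_right (abs_nonneg _))
  · rw [abs_of_nonpos hx]
    exact (le_abs_self _).trans (le_add_of_nonneg_left (abs_nonneg _))

lemma ExpBounded.integrable_of_le {f G : ℝ → ℝ} (hG : ExpBounded G)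
    (hf : AEStronglyMeasurable f) {a s : ℝ} (hs : -1 < s)
    (hle : ∀ x, |f x| ≤ |x - a| ^ s * (|G x| * Real.exp (-x ^ 2))) : Integrable f := by
  obtain ⟨C, hC⟩ := hG.abs_mul_exp_neg_sq_le a
  have h1 := ((integrable_abs_rpow_mul_exp_neg_mul_sq (b := 1 / 2) (by norm_num) hs).comp_sub_right
    a).const_mul C
  refine h1.mono' hf (Filter.Eventually.of_forall fun x => (hle x).trans ?_)
  calc |x - a| ^ s * (|G x| * Real.exp (-x ^ 2))
      ≤ |x - a| ^ s * (C * Real.exp (-(1 / 2) * (x - a) ^ 2)) :=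
        mul_le_mul_of_nonneg_left (hC x) (by positivity)
    _ = _ := by ring

/-- The Gaussian weight `exp (-x²) ∏ |x - t j| ^ γ j`. -/
noncomputable def singularGaussian {N : ℕ} (t γ : Fin N → ℝ) (x : ℝ) : ℝ :=
  Real.exp (-x ^ 2) * ∏ j, |x - t j| ^ γ j

namespace singularGaussian

variable {N : ℕ} {t γ : Fin N → ℝ}

lemma continuous (hγ : ∀ j, 0 < γ j) : Continuous (singularGaussian t γ) := by
  unfold singularGaussian
  refine (by fun_prop : Continuous fun x : ℝ => Real.exp (-x ^ 2)).mul
    (continuous_finsetProd _ fun j _ => ?_)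
  exact (by fun_prop : Continuous fun x : ℝ => |x - t j|).rpow_const fun _ => Or.inr (hγ j).le

lemma integrable_eval_mul (hγ : ∀ j, 0 < γ j) (p : ℝ[X]) :
    Integrable fun x => p.eval x * singularGaussian t γ x := by
  refine ((ExpBounded.eval p).mul (ExpBounded.prod_abs_sub_rpow Finset.univ t γ hγ)).integrable_of_le
    (p.continuous.mul (continuous hγ)).aestronglyMeasurable (a := 0) (s := 0) (by norm_num)
    fun x => le_of_eq ?_
  simp only [singularGaussian, abs_mul, Real.abs_exp, Real.rpow_zero]
  ring

lemma tendsto_eval_mul (hγ : ∀ j, 0 < γ j) (p : ℝ[X]) {l : Filter ℝ}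
    (hl : Filter.Tendsto (fun x : ℝ => x ^ 2) l Filter.atTop) :
    Filter.Tendsto (fun x => p.eval x * singularGaussian t γ x) l (nhds 0) := by
  obtain ⟨C, hC⟩ := ((ExpBounded.eval p).mul
    (ExpBounded.prod_abs_sub_rpow Finset.univ t γ hγ)).abs_mul_exp_neg_sq_le 0
  have h1 : Filter.Tendsto (fun x : ℝ => C * Real.exp (-(1 / 2) * (x - 0) ^ 2)) l (nhds 0) := by
    simp only [sub_zero]
    rw [← mul_zero C]
    exact (Real.tendsto_exp_atBot.comp (hl.const_mul_atTop_of_neg (by norm_num))).const_mul C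
  refine squeeze_zero_norm (fun x => (le_of_eq ?_).trans (hC x)) h1
  simp only [singularGaussian, Real.norm_eq_abs, abs_mul, Real.abs_exp]
  ring

lemma integrable_eval_mul_div (hγ : ∀ j, 0 < γ j) (p : ℝ[X]) (j : Fin N) :
    Integrable fun x => p.eval x * singularGaussian t γ x / (x - t j) := by
  refine ((ExpBounded.eval p).mul (ExpBounded.prod_abs_sub_rpow (Finset.univ.erase j) t γ
    hγ)).integrable_of_le ?_ (a := t j) (s := γ j - 1) (by linarith [hγ j]) fun x => ?_
  · exact ((p.continuous.mul (continuous hγ)).measurable.div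
      (measurable_id.sub_const (t j))).aestronglyMeasurable
  · rcases eq_or_ne x (t j) with hx | hx
    · simp only [hx, sub_self, div_zero, abs_zero]
      positivity
    · have h0 : 0 < |x - t j| := abs_pos.2 (sub_ne_zero.2 hx)
      rw [singularGaussian, ← Finset.mul_prod_erase _ _ (Finset.mem_univ j), Real.rpow_sub_one h0.ne']
      simp only [abs_div, abs_mul, Real.abs_exp, abs_of_nonneg (Real.rpow_nonneg h0.le (γ j))]
      apply le_of_eq
      ring

lemma hasDerivAt {x : ℝ} (hx : ∀ j, x ≠ t j) :
    HasDerivAt (singularGaussian t γ)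
      (singularGaussian t γ x * (-2 * x + ∑ j, γ j / (x - t j))) x := by
  have key : ∀ y, (∀ j, y ≠ t j) →
      singularGaussian t γ y = Real.exp (-y ^ 2 + ∑ j, γ j * Real.log (y - t j)) := by
    intro y hy
    rw [singularGaussian, Real.exp_add, Real.exp_sum]
    congr 1
    refine Finset.prod_congr rfl fun j _ => ?_
    rw [Real.rpow_def_of_pos (abs_pos.2 (sub_ne_zero.2 (hy j))), Real.log_abs, mul_comm]
  have hev : ∀ᶠ y in nhds x, ∀ j, y ≠ t j :=
    Filter.eventually_all.2 fun j => isOpen_ne.mem_nhds (hx j)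
  have hd : HasDerivAt (fun y : ℝ => -y ^ 2 + ∑ j, γ j * Real.log (y - t j))
      (-2 * x + ∑ j, γ j / (x - t j)) x := by
    refine HasDerivAt.add ?_ (HasDerivAt.fun_sum fun j _ => ?_)
    · simpa using (hasDerivAt_pow 2 x).fun_neg
    · simpa [div_eq_mul_inv] using
        (((hasDerivAt_id x).sub_const (t j)).log (sub_ne_zero.2 (hx j))).const_mul (γ j)
  rw [key x hx]
  exact hd.exp.congr_of_eventuallyEq (hev.mono fun y hy => key y hy)

/-- Integration by parts against the weight. -/
lemma sum_integral_eval_mul_div (hγ : ∀ j, 0 < γ j) (p : ℝ[X]) :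
    ∑ j, γ j * ∫ x, p.eval x * singularGaussian t γ x / (x - t j) =
      ∫ x, (2 * X * p - derivative p).eval x * singularGaussian t γ x := by
  set w := singularGaussian t γ
  set g : ℝ → ℝ := fun x => (∑ j, γ j * (p.eval x * w x / (x - t j))) -
    (2 * X * p - derivative p).eval x * w x with hg
  have hsum : Integrable fun x => ∑ j, γ j * (p.eval x * w x / (x - t j)) :=
    integrable_finsetSum _ fun j _ => (integrable_eval_mul_div hγ p j).const_mul _
  have hgi : Integrable g := hsum.sub (integrable_eval_mul hγ _)
  have hint : ∫ x, g x = 0 := by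
    have h1 := intervalIntegral_tendsto_integral hgi Filter.tendsto_neg_atTop_atBot Filter.tendsto_id
    have hpos := tendsto_eval_mul (t := t) hγ p (Filter.tendsto_pow_atTop two_ne_zero)
    have hsq : Filter.Tendsto (fun x : ℝ => x ^ 2) Filter.atBot Filter.atTop := by
      simpa [Function.comp_def] using (Filter.tendsto_pow_atTop (α := ℝ) two_ne_zero).comp
        Filter.tendsto_neg_atBot_atTop
    have hneg := (tendsto_eval_mul (t := t) hγ p hsq).comp Filter.tendsto_neg_atTop_atBot
    have h2 := hpos.sub hneg
    rw [sub_zero] at h2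
    refine tendsto_nhds_unique h1 (h2.congr fun a => ?_)
    refine (integral_eq_of_hasDerivAt_off_countable
      (fun x => p.eval x * w x) g (Set.finite_range t).countable
      (p.continuous.mul (continuous hγ)).continuousOn ?_ hgi.intervalIntegrable).symm
    rintro x ⟨-, hx⟩
    have hx' : ∀ j, x ≠ t j := fun j hj => hx ⟨j, hj.symm⟩
    refine ((p.hasDerivAt x).mul (hasDerivAt hx')).congr_deriv ?_
    simp only [hg, eval_sub, eval_mul, eval_X, eval_ofNat, mul_add, Finset.mul_sum]
    rw [Finset.sum_congr rfl fun j _ => show γ j * (p.eval x * w x / (x - t j)) =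
      p.eval x * (w x * (γ j / (x - t j))) by ring]
    ring
  rw [hg, integral_sub hsum (integrable_eval_mul hγ _),
    integral_finsetSum _ fun j _ => (integrable_eval_mul_div hγ p j).const_mul _, sub_eq_zero] at hint
  simpa only [integral_const_mul] using hint

end singularGaussian

lemma natDegree_le_iff_degree_lt_add_one {q : ℝ[X]} {n : ℕ} :
    q.natDegree ≤ n ↔ q.degree < (n + 1 : ℕ) := by
  rw [natDegree_le_iff_coeff_eq_zero, degree_lt_iff_coeff_zero]
  rfl

/-- `P` is the sequence of monic orthogonal polynomials of the functional `L`, with squared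
norms `h`. -/
structure IsMonicOrthogonal (L : ℝ[X] →ₗ[ℝ] ℝ) (P : ℕ → ℝ[X]) (h : ℕ → ℝ) : Prop where
  monic : ∀ n, (P n).Monic
  natDegree_eq : ∀ n, (P n).natDegree = n
  orthogonal : ∀ m n, m ≠ n → L (P m * P n) = 0
  norm_sq : ∀ n, L (P n * P n) = h n
  norm_pos : ∀ n, 0 < h n

namespace IsMonicOrthogonal

variable {L : ℝ[X] →ₗ[ℝ] ℝ} {P : ℕ → ℝ[X]} {h : ℕ → ℝ}

lemma coeff_self (H : IsMonicOrthogonal L P h) (n : ℕ) : (P n).coeff n = 1 := by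
  have := (H.monic n).coeff_natDegree
  rwa [H.natDegree_eq] at this

lemma degree_sub_lt (H : IsMonicOrthogonal L P h) {q : ℝ[X]} {m : ℕ} (hq : q.degree < (m + 1 : ℕ)) :
    (q - C (q.coeff m) * P m).degree < m := by
  rw [degree_lt_iff_coeff_zero] at hq ⊢
  intro k hk
  rw [coeff_sub, coeff_C_mul]
  rcases hk.eq_or_lt with rfl | hk
  · rw [H.coeff_self]; ring
  · rw [hq k hk, coeff_eq_zero_of_natDegree_lt (p := P m) (by rwa [H.natDegree_eq])]; ring

lemma map_C_mul (r : ℝ) (q : ℝ[X]) : L (C r * q) = r * L q := by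
  rw [← smul_eq_C_mul, map_smul, smul_eq_mul]

lemma map_mul_eq_zero (H : IsMonicOrthogonal L P h) {q : ℝ[X]} {n : ℕ} (hq : q.degree < n) :
    L (q * P n) = 0 := by
  suffices ∀ m ≤ n, ∀ q : ℝ[X], q.degree < m → L (q * P n) = 0 from this n le_rfl q hq
  intro m
  induction m with
  | zero =>
    intro _ q hq
    rw [degree_eq_bot.1 (Nat.WithBot.lt_zero_iff.1 hq)]
    simp
  | succ m ih =>
    intro hm q hq
    have h1 := ih (by lia) _ (H.degree_sub_lt hq)
    rw [sub_mul, mul_assoc, map_sub, map_C_mul, H.orthogonal m n (by lia)] at h1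
    simpa using h1

lemma map_mul (H : IsMonicOrthogonal L P h) {q : ℝ[X]} {n : ℕ} (hq : q.natDegree ≤ n) :
    L (q * P n) = q.coeff n * h n := by
  have h1 := H.map_mul_eq_zero
    (H.degree_sub_lt (natDegree_le_iff_degree_lt_add_one.1 hq))
  rw [sub_mul, mul_assoc, map_sub, map_C_mul, H.norm_sq] at h1
  linarith

lemma eq_zero_of_map_mul_eq_zero (H : IsMonicOrthogonal L P h) {q : ℝ[X]} {m : ℕ}
    (hq : q.degree < m) (hL : ∀ k < m, L (q * P k) = 0) : q = 0 := by
  induction m with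
  | zero => exact degree_eq_bot.1 (Nat.WithBot.lt_zero_iff.1 hq)
  | succ m ih =>
    have h1 := H.map_mul (natDegree_le_iff_degree_lt_add_one.2 hq)
    rw [hL m (by lia), eq_comm, mul_eq_zero, or_iff_left (H.norm_pos m).ne'] at h1
    have h2 := H.degree_sub_lt hq
    rw [h1] at h2
    exact ih (by simpa using h2) fun k hk => hL k (by lia)

/-- The three-term recurrence. At `n = 0` the junk term `P (0 - 1)` is killed by `β 0 = 0`. -/
lemma recurrence (H : IsMonicOrthogonal L P h) {α β : ℕ → ℝ} (hβ0 : β 0 = 0)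
    (hβ : ∀ n, β (n + 1) = h (n + 1) / h n) (hα : ∀ n, α n = L (X * P n * P n) / h n) (n : ℕ) :
    X * P n = P (n + 1) + C (α n) * P n + C (β n) * P (n - 1) := by
  have hd : ∀ k, (X * P k).natDegree = k + 1 := fun k => by
    rw [natDegree_X_mul (H.monic k).ne_zero, H.natDegree_eq]
  have hXc : ∀ k, (X * P k).coeff (k + 1) = 1 := fun k => by rw [coeff_X_mul, H.coeff_self]
  rw [← sub_eq_zero]
  refine H.eq_zero_of_map_mul_eq_zero (m := n + 1) ?_ ?_
  · rw [degree_lt_iff_coeff_zero]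
    intro k hk
    have h0 : ∀ j < n + 1, (P j).coeff k = 0 := fun j hj =>
      coeff_eq_zero_of_natDegree_lt (by rw [H.natDegree_eq]; lia)
    simp only [coeff_sub, coeff_add, coeff_C_mul, h0 n (by lia), h0 (n - 1) (by lia)]
    rcases hk.eq_or_lt with rfl | hk
    · rw [hXc, H.coeff_self]; ring
    · rw [coeff_eq_zero_of_natDegree_lt (by rwa [hd]),
        coeff_eq_zero_of_natDegree_lt (by rwa [H.natDegree_eq])]
      ring
  · intro k hk
    simp only [sub_mul, add_mul, map_sub, map_add, mul_assoc (C _), map_C_mul]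
    rw [H.orthogonal (n + 1) k (by lia)]
    rcases (Nat.lt_succ_iff.1 hk).eq_or_lt with rfl | hk
    · have h1 : β k * L (P (k - 1) * P k) = 0 := by
        cases k with
        | zero => simp [hβ0]
        | succ k => rw [H.orthogonal _ _ (by lia), mul_zero]
      rw [h1, H.norm_sq, hα k, div_mul_cancel₀ _ (H.norm_pos k).ne']
      ring
    · obtain ⟨n, rfl⟩ : ∃ l, n = l + 1 := ⟨n - 1, by lia⟩
      rw [show X * P (n + 1) * P k = X * P k * P (n + 1) by ring, H.orthogonal _ k hk.ne',
        H.map_mul (by rw [hd]; lia), Nat.add_sub_cancel]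
      rcases (Nat.lt_succ_iff.1 hk).eq_or_lt with rfl | hk
      · rw [hXc, H.norm_sq, hβ, div_mul_cancel₀ _ (H.norm_pos k).ne']
        ring
      · rw [coeff_eq_zero_of_natDegree_lt (by rw [hd]; lia), H.orthogonal _ _ hk.ne']
        ring

lemma map_two_mul_X_mul_sub_derivative (H : IsMonicOrthogonal L P h) {β : ℕ → ℝ} (hβ0 : β 0 = 0)
    (hβ : ∀ n, β (n + 1) = h (n + 1) / h n) (n : ℕ) :
    L (2 * X * (P n * (P (n + 1) - C (β n) * P (n - 1))) -
        derivative (P n * (P (n + 1) - C (β n) * P (n - 1)))) =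
      2 * h (n + 1) - 2 * β n * h n - h n := by
  have hX : ∀ k, L (X * P k * P (k + 1)) = h (k + 1) := fun k => by
    rw [H.map_mul (by rw [natDegree_X_mul (H.monic k).ne_zero, H.natDegree_eq]), coeff_X_mul,
      H.coeff_self, one_mul]
  have hdd : ∀ k, L (derivative (P (k + 1)) * P k) = (k + 1) * h k := fun k => by
    rw [H.map_mul ((natDegree_derivative_le _).trans (by rw [H.natDegree_eq]; lia)),
      coeff_derivative, H.coeff_self, one_mul]
  have hd0 : ∀ k m, k ≤ m → L (derivative (P k) * P m) = 0 := fun k m hkm => by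
    refine H.map_mul_eq_zero ((degree_derivative_lt (H.monic k).ne_zero).trans_le ?_)
    rw [degree_eq_natDegree (H.monic k).ne_zero, H.natDegree_eq]
    exact_mod_cast hkm
  have hb1 : β n * L (X * P (n - 1) * P n) = β n * h n := by
    cases n with
    | zero => simp [hβ0]
    | succ k => rw [Nat.add_sub_cancel, hX]
  have hb2 : β n * L (derivative (P n) * P (n - 1)) = n * h n := by
    cases n with
    | zero => simp [hβ0]
    | succ k =>
      rw [Nat.add_sub_cancel, hdd, hβ]
      have := (H.norm_pos k).ne'
      push_cast
      field_simp
  have hexp : 2 * X * (P n * (P (n + 1) - C (β n) * P (n - 1))) -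
        derivative (P n * (P (n + 1) - C (β n) * P (n - 1))) =
      C 2 * (X * P n * P (n + 1)) - C 2 * (C (β n) * (X * P (n - 1) * P n)) -
        derivative (P n) * P (n + 1) - derivative (P (n + 1)) * P n +
        C (β n) * (derivative (P n) * P (n - 1)) + C (β n) * (derivative (P (n - 1)) * P n) := by
    simp only [derivative_mul, derivative_sub, derivative_C, C_ofNat]
    ring
  rw [hexp]
  simp only [map_sub, map_add, map_C_mul]
  rw [hX, hb1, hd0 n (n + 1) (by lia), hdd, hb2, hd0 (n - 1) n (by lia)]
  ring

end IsMonicOrthogonal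

namespace singularGaussian

variable {N : ℕ} {t γ : Fin N → ℝ}

/-- The moment functional of the weight. -/
noncomputable def moment (hγ : ∀ j, 0 < γ j) : ℝ[X] →ₗ[ℝ] ℝ where
  toFun p := ∫ x, p.eval x * singularGaussian t γ x
  map_add' p q := by
    simp only [eval_add, add_mul]
    exact integral_add (integrable_eval_mul hγ p) (integrable_eval_mul hγ q)
  map_smul' r p := by
    simp only [eval_smul, smul_eq_mul, mul_assoc, RingHom.id_apply]
    exact integral_const_mul _ _

lemma integrable_cauchyTransform (hγ : ∀ j, 0 < γ j) (j : Fin N) {z : ℂ} (hz : z.im ≠ 0)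
    (p : ℝ[X]) : Integrable fun y : ℝ => ((p.eval y : ℝ) : ℂ) * (singularGaussian t γ y : ℂ) /
      (((y : ℂ) - (t j : ℂ)) * (z - (y : ℂ))) := by
  have h1 := (integrable_eval_mul_div (t := t) hγ p j).ofReal (𝕜 := ℂ)
  refine (h1.bdd_mul (f := fun y : ℝ => (z - (y : ℂ))⁻¹) (c := |z.im|⁻¹) ?_
    (Filter.Eventually.of_forall fun y => ?_)).congr (Filter.Eventually.of_forall fun y => ?_)
  · exact (by fun_prop : Measurable fun y : ℝ => (z - (y : ℂ))⁻¹).aestronglyMeasurable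
  · rw [norm_inv]
    refine inv_anti₀ (abs_pos.2 hz) ?_
    simpa using Complex.abs_im_le_norm (z - (y : ℂ))
  · simp only [Complex.coe_algebraMap]
    push_cast
    rw [div_mul_eq_div_div, div_eq_mul_inv _ (z - (y : ℂ)), mul_comm]

/-- `p ↦ ∫ p(y) w(y) / ((y - t j) (z - y)) dy`. -/
noncomputable def cauchyTransform (hγ : ∀ j, 0 < γ j) (j : Fin N) {z : ℂ} (hz : z.im ≠ 0) :
    ℝ[X] →ₗ[ℝ] ℂ where
  toFun p := ∫ y : ℝ, ((p.eval y : ℝ) : ℂ) * (singularGaussian t γ y : ℂ) /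
      (((y : ℂ) - (t j : ℂ)) * (z - (y : ℂ)))
  map_add' p q := by
    simp only [eval_add, Complex.ofReal_add, add_mul, add_div]
    exact integral_add (integrable_cauchyTransform hγ j hz p) (integrable_cauchyTransform hγ j hz q)
  map_smul' r p := by
    simp only [eval_smul, smul_eq_mul, Complex.ofReal_mul, mul_assoc, mul_div_assoc,
      RingHom.id_apply, Complex.real_smul]
    exact integral_const_mul _ _

lemma cauchyTransform_C_mul (hγ : ∀ j, 0 < γ j) (j : Fin N) {z : ℂ} (hz : z.im ≠ 0) (r : ℝ)
    (p : ℝ[X]) : cauchyTransform (t := t) hγ j hz (C r * p) = r * cauchyTransform (t := t) hγ j hz p := by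
  rw [← smul_eq_C_mul, map_smul, Complex.real_smul]

lemma cauchyTransform_X_sub_C_mul (hγ : ∀ j, 0 < γ j) (j : Fin N) {z : ℂ} (hz : z.im ≠ 0) (a : ℝ)
    (p : ℝ[X]) : cauchyTransform (t := t) hγ j hz ((X - C a) * p) =
      (z - a) * cauchyTransform (t := t) hγ j hz p -
        ((∫ y, p.eval y * singularGaussian t γ y / (y - t j) : ℝ) : ℂ) := by
  simp only [cauchyTransform, LinearMap.coe_mk, AddHom.coe_mk]
  rw [← integral_const_mul, ← integral_complex_ofReal]
  refine Eq.trans ?_ (integral_sub ((integrable_cauchyTransform hγ j hz p).const_mul _)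
    (integrable_eval_mul_div hγ p j).ofReal)
  refine integral_congr_ae (Filter.Eventually.of_forall fun y => ?_)
  have hzy : z - (y : ℂ) ≠ 0 := fun h0 => hz (by simpa using congrArg Complex.im h0)
  simp only [eval_mul, eval_sub, eval_X, eval_C]
  push_cast
  rcases eq_or_ne ((y : ℂ) - t j) 0 with h0 | h0
  · simp [h0]
  · field_simp
    ring

end singularGaussian

theorem compatibility_S2
    (N : ℕ) (hN : 1 ≤ N)
    (t γ : Fin N → ℝ) (ht : Function.Injective t) (hγ : ∀ j, 0 < γ j)
    (w : ℝ → ℝ) (hw : ∀ x : ℝ, w x = Real.exp (-x ^ 2) * ∏ j, |x - t j| ^ γ j)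
    (P : ℕ → Polynomial ℝ)
    (hPmonic : ∀ n, (P n).Monic) (hPdeg : ∀ n, (P n).natDegree = n)
    (horth : ∀ m n, m ≠ n → ∫ x : ℝ, (P m).eval x * (P n).eval x * w x = 0)
    (h : ℕ → ℝ) (hh : ∀ n, h n = ∫ x : ℝ, ((P n).eval x) ^ 2 * w x)
    (hhpos : ∀ n, 0 < h n)
    (β : ℕ → ℝ) (hβ0 : β 0 = 0) (hβ : ∀ n, β (n + 1) = h (n + 1) / h n)
    (α : ℕ → ℝ) (hα : ∀ n, α n = (∫ x : ℝ, x * ((P n).eval x) ^ 2 * w x) / h n)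
    (A B : ℕ → ℂ → ℂ)
    (hA : ∀ n (z : ℂ), A n z = 2 + ∑ j, ((γ j / h n : ℝ) : ℂ) *
      ∫ y : ℝ, (Complex.ofReal ((P n).eval y)) ^ 2 * (w y : ℂ) / (((y : ℂ) - (t j : ℂ)) * (z - (y : ℂ))))
    (hB0 : ∀ z : ℂ, B 0 z = 0)
    (hB : ∀ n (z : ℂ), B (n + 1) z = ∑ j, ((γ j / h n : ℝ) : ℂ) *
      ∫ y : ℝ, (Complex.ofReal ((P (n + 1)).eval y)) * (Complex.ofReal ((P n).eval y)) * (w y : ℂ) / (((y : ℂ) - (t j : ℂ)) * (z - (y : ℂ))))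
    (n : ℕ) (z : ℂ) (hz : z.im ≠ 0) :
    1 + (z - (α n : ℂ)) * (B (n + 1) z - B n z) = (β (n + 1) : ℂ) * A (n + 1) z - (β n : ℂ) * A (n - 1) z := by
  obtain rfl : w = singularGaussian t γ := funext hw
  let K := fun j => singularGaussian.cauchyTransform (t := t) hγ j hz
  have H : IsMonicOrthogonal (singularGaussian.moment (t := t) hγ) P h :=
    ⟨hPmonic, hPdeg, fun m n hmn => by simpa [singularGaussian.moment] using horth m n hmn,
      fun n => by simp [singularGaussian.moment, hh, sq], hhpos⟩
  have hrec := H.recurrence (α := α) hβ0 hβ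
    (fun n => by simp [singularGaussian.moment, hα, sq, mul_assoc]) n
  have hA' : ∀ m, A m z = 2 + ∑ j, ((γ j / h m : ℝ) : ℂ) * K j (P m * P m) := fun m => by
    simp [hA, K, singularGaussian.cauchyTransform, sq]
  have hB' : B (n + 1) z = ∑ j, ((γ j / h n : ℝ) : ℂ) * K j (P n * P (n + 1)) := by
    simp [hB, K, singularGaussian.cauchyTransform, mul_comm (Complex.ofReal (eval _ (P n)))]
  have hBn : B n z = ∑ j, ((γ j / h n : ℝ) : ℂ) * K j (P n * (C (β n) * P (n - 1))) := by
    cases n with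
    | zero => simp [hB0, hβ0]
    | succ k =>
      rw [hB]
      refine Finset.sum_congr rfl fun j _ => ?_
      rw [mul_left_comm, singularGaussian.cauchyTransform_C_mul, hβ, ← mul_assoc,
        ← Complex.ofReal_mul, show γ j / h (k + 1) * (h (k + 1) / h k) = γ j / h k by
          have := (hhpos (k + 1)).ne'
          field_simp]
      simp [singularGaussian.cauchyTransform]
  have hAsucc : (β (n + 1) : ℂ) * A (n + 1) z = 2 * β (n + 1) +
      ∑ j, ((γ j / h n : ℝ) : ℂ) * K j (P (n + 1) * P (n + 1)) := by
    rw [hA', mul_add, mul_comm (β _ : ℂ), Finset.mul_sum]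
    congr 1
    refine Finset.sum_congr rfl fun j _ => ?_
    rw [← mul_assoc, ← Complex.ofReal_mul, hβ]
    congr 2
    have := (hhpos (n + 1)).ne'
    field_simp
  have hApred : (β n : ℂ) * A (n - 1) z = 2 * β n +
      ∑ j, ((γ j / h n : ℝ) : ℂ) * K j ((C (β n) * P (n - 1)) * (C (β n) * P (n - 1))) := by
    cases n with
    | zero => simp [hβ0]
    | succ k =>
      rw [hA', mul_add, mul_comm (β _ : ℂ), Finset.mul_sum]
      congr 1
      refine Finset.sum_congr rfl fun j _ => ?_
      rw [Nat.add_sub_cancel, mul_mul_mul_comm, ← C_mul, singularGaussian.cauchyTransform_C_mul,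
        ← mul_assoc, ← mul_assoc, ← Complex.ofReal_mul, ← Complex.ofReal_mul, hβ]
      congr 2
      have := (hhpos (k + 1)).ne'
      field_simp
  set Q := P n * (P (n + 1) - C (β n) * P (n - 1)) with hQ
  have hfactor : P (n + 1) * P (n + 1) - (C (β n) * P (n - 1)) * (C (β n) * P (n - 1)) =
      (X - C (α n)) * Q := by
    have : (X - C (α n)) * P n = P (n + 1) + C (β n) * P (n - 1) := by rw [sub_mul, hrec]; ring
    linear_combination -(P (n + 1) - C (β n) * P (n - 1)) * this
  have hparts : ∑ j, γ j / h n * ∫ y, Q.eval y * singularGaussian t γ y / (y - t j) =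
      2 * β (n + 1) - 2 * β n - 1 := by
    have h1 := (singularGaussian.sum_integral_eval_mul_div (t := t) hγ Q).trans
      (H.map_two_mul_X_mul_sub_derivative hβ0 hβ n)
    have h2 := (hhpos n).ne'
    simp only [div_mul_eq_mul_div]
    rw [← Finset.sum_div, h1, hβ]
    field_simp
  have hBdiff : B (n + 1) z - B n z = ∑ j, ((γ j / h n : ℝ) : ℂ) * K j Q := by
    rw [hB', hBn, ← Finset.sum_sub_distrib]
    refine Finset.sum_congr rfl fun j _ => ?_
    rw [← mul_sub, ← map_sub, ← mul_sub]
  have hsum : ∑ j, ((γ j / h n : ℝ) : ℂ) * K j (P (n + 1) * P (n + 1)) -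
      ∑ j, ((γ j / h n : ℝ) : ℂ) * K j ((C (β n) * P (n - 1)) * (C (β n) * P (n - 1))) =
      (z - α n) * (B (n + 1) z - B n z) - (2 * β (n + 1) - 2 * β n - 1) := by
    have h1 := congrArg Complex.ofReal hparts
    push_cast at h1
    rw [← h1, hBdiff, Finset.mul_sum, ← Finset.sum_sub_distrib, ← Finset.sum_sub_distrib]
    refine Finset.sum_congr rfl fun j _ => ?_
    rw [← mul_sub, ← map_sub, hfactor, singularGaussian.cauchyTransform_X_sub_C_mul]
    push_cast
    ring
  rw [hAsucc, hApred]
  linear_combination -hsum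
end

section
/- (Sum rule (S₂′), Theorem 2.3.) For every integer n ≥ 0 and every z ∈ ℂ with Im z ≠ 0: B_n(z)² + 2z·B_n(z) + Σ_{i=0}^{n−1} A_i(z) = β_n·A_n(z)·A_{n−1}(z), where for n = 0 both sides are interpreted as 0 (B_0 = 0, β_0 = 0 and an empty sum). -/
open MeasureTheory Polynomial

section OrthogonalPolynomials

variable {P : ℕ → ℝ[X]} {L S T : ℝ[X] →ₗ[ℝ] ℂ} {h : ℕ → ℝ} {z : ℂ}

theorem degree_sub_coeff_mul_lt (hmonic : ∀ n, (P n).Monic) (hdeg : ∀ n, (P n).natDegree = n)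
    {n : ℕ} {f : ℝ[X]} (hf : f.degree < (n + 1 : ℕ)) :
    (f - C (f.coeff n) * P n).degree < n := by
  rw [degree_lt_iff_coeff_zero] at hf ⊢
  intro m hm
  rcases hm.eq_or_lt with rfl | hm
  · have := (hmonic n).coeff_natDegree
    rw [hdeg] at this
    simp [this]
  · have : (P n).coeff m = 0 := coeff_eq_zero_of_natDegree_lt (by rwa [hdeg])
    simp [this, hf m hm]

theorem orthogonal_of_degree_lt (hmonic : ∀ n, (P n).Monic) (hdeg : ∀ n, (P n).natDegree = n)
    (horth : ∀ m n, m ≠ n → L (P m * P n) = 0) {n : ℕ} :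
    ∀ k ≤ n, ∀ f : ℝ[X], f.degree < (k : ℕ) → L (f * P n) = 0 := by
  intro k
  induction k with
  | zero =>
    intro _ f hf
    have : f = 0 := by simpa [degree_lt_iff_coeff_zero, Polynomial.ext_iff] using hf
    simp [this]
  | succ k ih =>
    intro hk f hf
    have h1 := ih (by omega) _ (degree_sub_coeff_mul_lt hmonic hdeg hf)
    rw [sub_mul, mul_assoc, C_mul', map_sub, map_smul, horth k n (by omega)] at h1
    simpa using h1

theorem eq_zero_of_orthogonal (hmonic : ∀ n, (P n).Monic) (hdeg : ∀ n, (P n).natDegree = n)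
    (horth : ∀ m n, m ≠ n → L (P m * P n) = 0) (hnorm : ∀ n, L (P n * P n) = h n)
    (hpos : ∀ n, 0 < h n) :
    ∀ (k : ℕ) (f : ℝ[X]), f.degree < (k : ℕ) → (∀ m < k, L (f * P m) = 0) → f = 0 := by
  intro k
  induction k with
  | zero =>
    intro f hf _
    simpa [degree_lt_iff_coeff_zero, Polynomial.ext_iff] using hf
  | succ k ih =>
    intro f hf hfo
    have h1 := ih _ (degree_sub_coeff_mul_lt hmonic hdeg hf) fun m hm => by
      rw [sub_mul, mul_assoc, C_mul', map_sub, map_smul, horth k m (by omega), hfo m (by omega)]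
      simp
    rw [sub_eq_zero] at h1
    have h2 := hfo k (by omega)
    rw [h1, mul_assoc, C_mul', map_smul, hnorm] at h2
    have h3 : f.coeff k = 0 := by simpa [(hpos k).ne'] using h2
    rw [h1, h3]; simp

theorem degree_X_mul_sub_lt (hmonic : ∀ n, (P n).Monic) (hdeg : ∀ n, (P n).natDegree = n) (n : ℕ) :
    (X * P n - P (n + 1)).degree < ((n + 1 : ℕ) : WithBot ℕ) := by
  rw [degree_lt_iff_coeff_zero]
  intro m hm
  obtain ⟨m, rfl⟩ : ∃ k, m = k + 1 := ⟨m - 1, by omega⟩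
  rw [coeff_sub, coeff_X_mul]
  rcases (Nat.le_of_succ_le_succ hm).eq_or_lt with rfl | hm
  · have h1 := (hmonic n).coeff_natDegree
    have h2 := (hmonic (n + 1)).coeff_natDegree
    rw [hdeg] at h1 h2
    simp [h1, h2]
  · rw [coeff_eq_zero_of_natDegree_lt (by rwa [hdeg]),
      coeff_eq_zero_of_natDegree_lt (by rw [hdeg]; omega), sub_zero]

theorem three_term_recurrence (hmonic : ∀ n, (P n).Monic) (hdeg : ∀ n, (P n).natDegree = n)
    (horth : ∀ m n, m ≠ n → L (P m * P n) = 0) (hnorm : ∀ n, L (P n * P n) = h n)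
    (hpos : ∀ n, 0 < h n) (n : ℕ) :
    ∃ a : ℝ, P (n + 2) = X * P (n + 1) - C a * P (n + 1) - C (h (n + 1) / h n) * P n := by
  set R := X * P (n + 1) - P (n + 2) with hR
  have hR1 := degree_sub_coeff_mul_lt hmonic hdeg (degree_X_mul_sub_lt hmonic hdeg (n + 1))
  rw [← hR] at hR1
  set a := R.coeff (n + 1)
  have hR2 := degree_sub_coeff_mul_lt hmonic hdeg hR1
  set b := (R - C a * P (n + 1)).coeff n
  have expand : ∀ m, L ((R - C a * P (n + 1) - C b * P n) * P m) = L (X * P m * P (n + 1))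
      - L (P (n + 2) * P m) - a * L (P (n + 1) * P m) - b * L (P n * P m) := by
    intro m
    have : (R - C a * P (n + 1) - C b * P n) * P m = X * P m * P (n + 1) - P (n + 2) * P m
        - a • (P (n + 1) * P m) - b • (P n * P m) := by
      simp only [smul_eq_C_mul, hR]; ring
    simp [this]
  have hzero : R - C a * P (n + 1) - C b * P n = 0 := by
    refine eq_zero_of_orthogonal hmonic hdeg horth hnorm hpos n _ hR2 fun m hm => ?_
    rw [expand, horth _ _ (by omega), horth _ _ (by omega), horth _ _ (by omega),
      orthogonal_of_degree_lt hmonic hdeg horth (m + 2) (by omega)]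
    · simp
    · refine degree_lt_iff_coeff_zero _ _ |>.2 fun k hk => coeff_eq_zero_of_natDegree_lt ?_
      have := natDegree_mul_le (p := X) (q := P m)
      simp only [natDegree_X, hdeg] at this
      omega
  have hb := expand n
  have hX := orthogonal_of_degree_lt hmonic hdeg horth (n + 1) le_rfl _
    (degree_X_mul_sub_lt hmonic hdeg n)
  rw [sub_mul, map_sub, hnorm, sub_eq_zero] at hX
  rw [hzero, hX, horth _ _ (by omega), horth _ _ (by omega), hnorm] at hb
  have hb' : b = h (n + 1) / h n := by
    rw [eq_div_iff (hpos n).ne']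
    simp only [zero_mul, map_zero, mul_zero, sub_zero] at hb
    exact_mod_cast (sub_eq_zero.1 hb.symm).symm
  refine ⟨a, ?_⟩
  rw [← hb']
  linear_combination hR - hzero

theorem map_mul_of_stieltjes_rec (hS : ∀ f, S (X * f) = z * S f - L f) (g : ℝ[X]) :
    ∀ (m : ℕ), (∀ f : ℝ[X], f.degree < (m : ℕ) → L (f * g) = 0) →
    ∀ f : ℝ[X], f.degree < (m + 1 : ℕ) → S (f * g) = aeval z f * S g := by
  intro m
  induction m with
  | zero =>
    intro _ f hf
    have : f = C (f.coeff 0) := eq_C_of_degree_le_zero (by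
      exact degree_le_iff_coeff_zero _ _ |>.2 fun k hk =>
        (degree_lt_iff_coeff_zero _ _).1 hf k (by exact_mod_cast hk))
    rw [this, C_mul', map_smul]; simp
  | succ m ih =>
    intro hg f hf
    have hd : f.divX.degree < (m + 1 : ℕ) := degree_lt_iff_coeff_zero _ _ |>.2 fun k hk => by
      rw [coeff_divX]; exact (degree_lt_iff_coeff_zero _ _).1 hf _ (by omega)
    have h1 := ih (fun f hf => hg f (hf.trans (by exact_mod_cast Nat.lt_succ_self m))) _ hd
    have h2 := hg _ hd
    have e : f * g = X * (f.divX * g) + f.coeff 0 • g := by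
      rw [smul_eq_C_mul]; nth_rewrite 1 [← divX_mul_X_add f]; ring
    rw [e, map_add, hS, h1, h2]
    nth_rewrite 3 [← divX_mul_X_add f]
    simp; ring

theorem map_mul_of_stieltjes_deriv_rec (hS : ∀ f, S (X * f) = z * S f - L f)
    (hT : ∀ f, T (X * f) = z * T f + S f) (g : ℝ[X]) :
    ∀ (m : ℕ), (∀ f : ℝ[X], f.degree < (m : ℕ) → L (f * g) = 0) →
    ∀ f : ℝ[X], f.degree < (m + 2 : ℕ) →
      T (f * g) = aeval z f * T g + aeval z (derivative f) * S g := by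
  intro m hg
  suffices ∀ k ≤ m + 2, ∀ f : ℝ[X], f.degree < (k : ℕ) →
      T (f * g) = aeval z f * T g + aeval z (derivative f) * S g from this _ le_rfl
  intro k
  induction k with
  | zero =>
    intro _ f hf
    have : f = 0 := by simpa [degree_lt_iff_coeff_zero, Polynomial.ext_iff] using hf
    simp [this]
  | succ k ih =>
    intro hk f hf
    have hd : f.divX.degree < (k : ℕ) := degree_lt_iff_coeff_zero _ _ |>.2 fun j hj => by
      rw [coeff_divX]; exact (degree_lt_iff_coeff_zero _ _).1 hf _ (by omega)
    have h1 := ih (by omega) _ hd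
    have h2 := map_mul_of_stieltjes_rec hS g m hg f.divX
      (hd.trans_le (by exact_mod_cast (by omega : k ≤ m + 1)))
    have e : f * g = X * (f.divX * g) + f.coeff 0 • g := by
      rw [smul_eq_C_mul]; nth_rewrite 1 [← divX_mul_X_add f]; ring
    have e2 : aeval z f = aeval z f.divX * z + f.coeff 0 := by
      nth_rewrite 1 [← divX_mul_X_add f]; simp
    have e3 : aeval z (derivative f) = aeval z (derivative f.divX) * z + aeval z f.divX := by
      nth_rewrite 1 [← divX_mul_X_add f]; simp
    rw [e, map_add, hT, h1, h2, e2, e3]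
    simp; ring

/-- The sum rule, for Stieltjes-type functionals `S` (values at `z`) and `T` (derivatives at `z`)
of a moment functional `L`. -/
theorem sum_rule_of_functionals (hmonic : ∀ n, (P n).Monic) (hdeg : ∀ n, (P n).natDegree = n)
    (horth : ∀ m n, m ≠ n → L (P m * P n) = 0) (hnorm : ∀ n, L (P n * P n) = h n)
    (hpos : ∀ n, 0 < h n)
    (hS : ∀ f, S (X * f) = z * S f - L f) (hT : ∀ f, T (X * f) = z * T f + S f)
    (A B : ℕ → ℂ)
    (hA : ∀ n, h n * A n = 2 * z * S (P n * P n) - S (derivative (P n * P n)) + T (P n * P n))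
    (hB : ∀ n, h n * B (n + 1) = 2 * z * S (P (n + 1) * P n)
      - S (derivative (P (n + 1) * P n)) + T (P (n + 1) * P n)) (n : ℕ) :
    B (n + 1) ^ 2 + 2 * z * B (n + 1) + ∑ i ∈ Finset.range (n + 1), A i
      = (h (n + 1) / h n : ℂ) * A (n + 1) * A n := by
  have hL : ∀ n (f : ℝ[X]), f.degree < (n : ℕ) → L (f * P n) = 0 := fun n =>
    orthogonal_of_degree_lt hmonic hdeg horth n le_rfl
  have hSm : ∀ n (f : ℝ[X]), f.degree < (n + 1 : ℕ) → S (f * P n) = aeval z f * S (P n) :=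
    fun n => map_mul_of_stieltjes_rec hS (P n) n (hL n)
  have hTm : ∀ n (f : ℝ[X]), f.degree < (n + 2 : ℕ) →
      T (f * P n) = aeval z f * T (P n) + aeval z (derivative f) * S (P n) :=
    fun n => map_mul_of_stieltjes_deriv_rec hS hT (P n) n (hL n)
  have hne : ∀ n, (h n : ℂ) ≠ 0 := fun n => by exact_mod_cast (hpos n).ne'
  have hdegP : ∀ n m, n < m → (P n).degree < (m : ℕ) := fun n m hnm => by
    rw [degree_eq_natDegree (hmonic n).ne_zero, hdeg]; exact_mod_cast hnm
  have hdegP' : ∀ n m, n < m + 1 → (derivative (P n)).degree < (m + 1 : ℕ) := fun n m hnm =>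
    (degree_derivative_lt (hmonic n).ne_zero).trans (hdegP n _ hnm)
  have hdegP'' : ∀ n, (derivative (P (n + 1))).degree < (n + 1 : ℕ) := fun n => by
    have := degree_derivative_lt (hmonic (n + 1)).ne_zero
    rwa [degree_eq_natDegree (hmonic _).ne_zero, hdeg] at this
  set p : ℕ → ℂ := fun n => aeval z (P n) with hp
  set p' : ℕ → ℂ := fun n => aeval z (derivative (P n)) with hp'
  set q : ℕ → ℂ := fun n => S (P n) with hq
  set q' : ℕ → ℂ := fun n => T (P n) with hq'
  have hA' : ∀ n, h n * A n = p n * (q' n + 2 * z * q n) - p' n * q n := fun n => by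
    rw [hA, derivative_mul, mul_comm (P n) (derivative (P n)), map_add,
      hSm n _ (hdegP n _ (by omega)), hSm n _ (hdegP' n _ (by omega)),
      hTm n _ (hdegP n _ (by omega))]
    ring
  have hT2 : ∀ n, T (P (n + 1) * P n) = p n * q' (n + 1) + p' n * q (n + 1) := fun n => by
    rw [mul_comm, hTm (n + 1) _ (hdegP n _ (by omega))]
  have hS2 : ∀ n, S (P (n + 1) * P n) = p n * q (n + 1) := fun n => by
    rw [mul_comm, hSm (n + 1) _ (hdegP n _ (by omega))]
  have hB' : ∀ n, h n * B (n + 1) = p n * (q' (n + 1) + 2 * z * q (n + 1)) - p' (n + 1) * q n :=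
    fun n => by
    rw [hB, derivative_mul, map_add, hSm n _ (hdegP'' n),
      mul_comm (P (n + 1)) (derivative (P n)), hSm (n + 1) _ (hdegP' n _ (by omega)), hS2, hT2]
    ring
  have hW : ∀ n, p (n + 1) * q n - p n * q (n + 1) = h n := fun n => by
    have h1 := hSm n _ (degree_X_mul_sub_lt hmonic hdeg n)
    rw [sub_mul, map_sub, hS2, mul_assoc, hS, hSm n _ (hdegP n _ (by omega)), hnorm] at h1
    simp only [map_sub, map_mul, aeval_X] at h1
    simp only [hp, hq]
    linear_combination h1
  have hW' : ∀ n, p n * q' (n + 1) + p' n * q (n + 1) = p (n + 1) * q' n + p' (n + 1) * q n :=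
    fun n => by
    rw [← hT2, hTm n _ (hdegP (n + 1) _ (by omega))]
  have hP0 : P 0 = 1 := (hmonic 0).natDegree_eq_zero.1 (hdeg 0)
  have hsum : ∀ n, h n * ∑ i ∈ Finset.range (n + 1), A i
      = p' (n + 1) * (q' n + 2 * z * q n) - p' n * (q' (n + 1) + 2 * z * q (n + 1)) := by
    intro n
    induction n with
    | zero =>
      have h1 : p 0 = 1 := by simp [hp, hP0]
      have h2 : p' 0 = 0 := by simp [hp', hP0]
      have h3 : derivative (P 1) = 1 := by
        have h4 : P 1 = X + C ((P 1).coeff 0) := (hmonic 1).eq_X_add_C (hdeg 1)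
        rw [h4]; simp
      have h4 : p' 1 = 1 := by simp [hp', h3]
      simp [hA', h1, h2, h4]
    | succ n ih =>
      obtain ⟨a, ha⟩ := three_term_recurrence hmonic hdeg horth hnorm hpos n
      have hL1 : L (P (n + 1)) = 0 := by
        simpa using hL (n + 1) 1 (by rw [degree_one]; exact_mod_cast Nat.succ_pos n)
      have e1 : p' (n + 2) = p (n + 1) + z * p' (n + 1) - a * p' (n + 1)
          - (h (n + 1) / h n) * p' n := by
        simp only [hp, hp', ha, derivative_mul, derivative_X, derivative_C,
          map_sub, map_add, map_mul, aeval_X, aeval_C]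
        simp
      have e2 : q (n + 2) = z * q (n + 1) - a * q (n + 1) - (h (n + 1) / h n) * q n := by
        simp only [hq, ha, map_sub, hS, hL1, C_mul', map_smul]
        simp
      have e3 : q' (n + 2) = z * q' (n + 1) + q (n + 1) - a * q' (n + 1)
          - (h (n + 1) / h n) * q' n := by
        simp only [hq, hq', ha, map_sub, hT, C_mul', map_smul]
        simp
      rw [Finset.sum_range_succ, mul_add, hA', e1, e2, e3]
      have hn := hne n
      field_simp
      linear_combination h (n + 1) * ih
  have hn := hne n
  have key : (h n : ℂ) ^ 2 * (B (n + 1) ^ 2 + 2 * z * B (n + 1)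
      + ∑ i ∈ Finset.range (n + 1), A i) = (h (n + 1) * A (n + 1)) * (h n * A n) := by
    have e : (h n : ℂ) ^ 2 * (B (n + 1) ^ 2 + 2 * z * B (n + 1)
      + ∑ i ∈ Finset.range (n + 1), A i) = (h n * B (n + 1)) * (h n * B (n + 1) + 2 * z * h n)
        + h n * (h n * ∑ i ∈ Finset.range (n + 1), A i) := by ring
    rw [e, hA', hA', hB', hsum, ← hW]
    linear_combination (-(p n * (q' (n + 1) + 2 * z * q (n + 1)) - p' (n + 1) * q n)) * (-hW' n)
  apply mul_left_cancel₀ (pow_ne_zero 2 hn)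
  rw [key]
  field_simp

end OrthogonalPolynomials

section SubGaussian

/-- `g` grows slower than every Gaussian `exp (ε x ^ 2)`, `ε > 0`. -/
def SubGaussianGrowth (g : ℝ → ℝ) : Prop :=
  ∀ ε > 0, ∃ K, ∀ x, |g x| ≤ K * Real.exp (ε * x ^ 2)

namespace SubGaussianGrowth

theorem mul {f g : ℝ → ℝ} (hf : SubGaussianGrowth f) (hg : SubGaussianGrowth g) :
    SubGaussianGrowth fun x => f x * g x := by
  intro ε hε
  obtain ⟨K, hK⟩ := hf (ε / 2) (by positivity)
  obtain ⟨M, hM⟩ := hg (ε / 2) (by positivity)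
  refine ⟨K * M, fun x => ?_⟩
  calc |f x * g x| = |f x| * |g x| := abs_mul _ _
    _ ≤ (K * Real.exp (ε / 2 * x ^ 2)) * (M * Real.exp (ε / 2 * x ^ 2)) :=
      mul_le_mul (hK x) (hM x) (abs_nonneg _) ((abs_nonneg _).trans (hK x))
    _ = K * M * (Real.exp (ε / 2 * x ^ 2) * Real.exp (ε / 2 * x ^ 2)) := by ring
    _ = _ := by rw [← Real.exp_add]; ring_nf

theorem add {f g : ℝ → ℝ} (hf : SubGaussianGrowth f) (hg : SubGaussianGrowth g) :
    SubGaussianGrowth fun x => f x + g x := by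
  intro ε hε
  obtain ⟨K, hK⟩ := hf ε hε
  obtain ⟨M, hM⟩ := hg ε hε
  exact ⟨K + M, fun x => (abs_add_le _ _).trans (by linarith [hK x, hM x])⟩

theorem const (c : ℝ) : SubGaussianGrowth fun _ => c := fun ε hε =>
  ⟨|c|, fun x => le_mul_of_one_le_right (abs_nonneg c) (Real.one_le_exp (by positivity))⟩

theorem id : SubGaussianGrowth fun x => x := by
  intro ε hε
  refine ⟨1 + ε⁻¹, fun x => ?_⟩
  have h1 : ε * x ^ 2 + 1 ≤ Real.exp (ε * x ^ 2) := Real.add_one_le_exp _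
  have h2 : 1 ≤ Real.exp (ε * x ^ 2) := Real.one_le_exp (by positivity)
  have h3 : x ^ 2 ≤ ε⁻¹ * Real.exp (ε * x ^ 2) := by
    rw [inv_mul_eq_div, le_div_iff₀ hε]; linarith
  have h4 : |x| ≤ 1 + x ^ 2 := by
    rw [← sq_abs]; nlinarith [sq_nonneg (|x| - 1), abs_nonneg x]
  linarith

theorem abs_rpow {f : ℝ → ℝ} (hf : SubGaussianGrowth f) {γ : ℝ} (hγ : 0 < γ) :
    SubGaussianGrowth fun x => |f x| ^ γ := by
  intro ε hε
  obtain ⟨K, hK⟩ := hf (ε / γ) (by positivity)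
  have hK0 : 0 ≤ K := by simpa using (abs_nonneg _).trans (hK 0)
  refine ⟨K ^ γ, fun x => ?_⟩
  rw [abs_of_nonneg (by positivity)]
  calc |f x| ^ γ ≤ (K * Real.exp (ε / γ * x ^ 2)) ^ γ :=
        Real.rpow_le_rpow (abs_nonneg _) (hK x) hγ.le
    _ = K ^ γ * Real.exp (ε * x ^ 2) := by
      rw [Real.mul_rpow hK0 (Real.exp_pos _).le, ← Real.exp_mul]
      congr 2; field_simp

theorem prod {ι : Type*} (s : Finset ι) {f : ι → ℝ → ℝ} (hf : ∀ i, SubGaussianGrowth (f i)) :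
    SubGaussianGrowth fun x => ∏ i ∈ s, f i x := by
  classical
  induction s using Finset.induction_on with
  | empty => simpa using const 1
  | insert a s ha ih => simpa [Finset.prod_insert ha] using (hf a).mul ih

theorem polynomial (f : ℝ[X]) : SubGaussianGrowth fun x => f.eval x := by
  induction f using Polynomial.induction_on' with
  | add p q hp hq => simpa using hp.add hq
  | monomial n a =>
    simpa using (const a).mul (by simpa using prod (Finset.range n) fun _ => id)

theorem exists_bound {g : ℝ → ℝ} (hg : SubGaussianGrowth g) :
    ∃ K, ∀ x, |g x * Real.exp (-x ^ 2)| ≤ K * Real.exp (-(1 / 2) * x ^ 2) := by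
  obtain ⟨K, hK⟩ := hg (1 / 2) (by norm_num)
  refine ⟨K, fun x => ?_⟩
  rw [abs_mul, Real.abs_exp]
  calc |g x| * Real.exp (-x ^ 2) ≤ K * Real.exp (1 / 2 * x ^ 2) * Real.exp (-x ^ 2) := by
        gcongr; exact hK x
    _ = _ := by rw [mul_assoc, ← Real.exp_add]; ring_nf

theorem integrable {g : ℝ → ℝ} (hg : SubGaussianGrowth g) (hc : Continuous g) :
    Integrable fun x => g x * Real.exp (-x ^ 2) := by
  obtain ⟨K, hK⟩ := hg.exists_bound
  exact ((integrable_exp_neg_mul_sq (by norm_num)).const_mul K).mono'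
    (by fun_prop) (ae_of_all _ hK)

theorem tendsto_zero {g : ℝ → ℝ} (hg : SubGaussianGrowth g) :
    Filter.Tendsto (fun x => g x * Real.exp (-x ^ 2)) (Filter.cocompact ℝ) (nhds 0) := by
  obtain ⟨K, hK⟩ := hg.exists_bound
  refine squeeze_zero_norm hK ?_
  have h1 := tendsto_rpow_abs_mul_exp_neg_mul_sq_cocompact (a := 1 / 2) (by norm_num) 0
  simpa using h1.const_mul K

end SubGaussianGrowth

end SubGaussian

section Weight

theorem integrableOn_Icc_abs_rpow_div {γ : ℝ} (hγ : 0 < γ) (t : ℝ) :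
    IntegrableOn (fun x => |x - t| ^ γ / (x - t)) (Set.Icc (t - 1) (t + 1)) := by
  have h1 : IntervalIntegrable (fun x : ℝ => |x| ^ γ / x) volume 0 1 := by
    refine (intervalIntegral.intervalIntegrable_rpow' (r := γ - 1) (by linarith)).congr ?_
    intro x hx
    rw [Set.uIoc_of_le zero_le_one] at hx
    simp only [abs_of_pos hx.1, Real.rpow_sub_one hx.1.ne']
  have h2 : IntervalIntegrable (fun x : ℝ => |x| ^ γ / x) volume (-1) 0 := by
    have := ((IntervalIntegrable.iff_comp_neg).1 h1).symm.neg
    simpa [Pi.neg_def, div_neg] using this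
  have h3 := (h2.trans h1).comp_sub_right t
  rwa [neg_add_eq_sub, add_comm 1 t,
    intervalIntegrable_iff_integrableOn_Icc_of_le (by linarith)] at h3

theorem integrable_mul_abs_rpow_div {γ t : ℝ} (hγ : 0 < γ) {ψ : ℝ → ℝ} (hψ : Continuous ψ)
    (hi : Integrable fun x => ψ x * |x - t| ^ γ) :
    Integrable fun x => ψ x * (|x - t| ^ γ / (x - t)) := by
  have h1 := (integrableOn_Icc_abs_rpow_div hγ t).continuousOn_mul hψ.continuousOn isCompact_Icc
  have h2 : IntegrableOn (fun x => ψ x * (|x - t| ^ γ / (x - t))) (Set.Icc (t - 1) (t + 1))ᶜ := by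
    refine hi.norm.integrableOn.mono'
      (hψ.measurable.mul (by fun_prop)).aestronglyMeasurable ?_
    refine (ae_restrict_iff' measurableSet_Icc.compl).2 (ae_of_all _ fun x hx => ?_)
    have h3 : 1 ≤ |x - t| := by
      by_contra! h
      rw [abs_lt] at h
      exact hx ⟨by linarith, by linarith⟩
    rw [← mul_div_assoc, norm_div]
    exact div_le_self (norm_nonneg _) h3
  simpa using h1.union h2

theorem hasDerivAt_abs_sub_rpow {γ t x : ℝ} (hx : x ≠ t) :
    HasDerivAt (fun y => |y - t| ^ γ) (γ / (x - t) * |x - t| ^ γ) x := by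
  have h0 : x - t ≠ 0 := sub_ne_zero.2 hx
  have h1 := ((hasDerivAt_abs h0).comp_sub_const x t).rpow_const (p := γ) (.inl (abs_ne_zero.2 h0))
  convert h1 using 1
  rw [Real.rpow_sub_one (abs_ne_zero.2 h0)]
  generalize x - t = u at h0
  rcases h0.lt_or_gt with h | h
  · rw [sign_neg h, abs_of_neg h]; simp; field_simp
  · rw [sign_pos h, abs_of_pos h]; simp; field_simp

variable {N : ℕ} {t γ : Fin N → ℝ} {w : ℝ → ℝ}

theorem continuous_weight (hγ : ∀ j, 0 < γ j)
    (hw : ∀ x : ℝ, w x = Real.exp (-x ^ 2) * ∏ j, |x - t j| ^ γ j) : Continuous w := by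
  rw [funext hw]
  refine Continuous.mul (by fun_prop) (continuous_finsetProd _ fun j _ => ?_)
  exact Continuous.rpow_const (by fun_prop) fun x => .inr (hγ j).le

theorem SubGaussianGrowth.weight_factor (hγ : ∀ j, 0 < γ j) (s : Finset (Fin N)) :
    SubGaussianGrowth fun x => ∏ j ∈ s, |x - t j| ^ γ j :=
  prod s fun j => abs_rpow (by simpa [sub_eq_add_neg] using id.add (const (-t j))) (hγ j)

theorem integrable_polynomial_mul_weight (hγ : ∀ j, 0 < γ j)
    (hw : ∀ x : ℝ, w x = Real.exp (-x ^ 2) * ∏ j, |x - t j| ^ γ j) (f : ℝ[X]) :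
    Integrable fun x => f.eval x * w x := by
  have h1 := ((SubGaussianGrowth.polynomial f).mul
    (SubGaussianGrowth.weight_factor (t := t) hγ Finset.univ)).integrable (by
      refine f.continuous.mul (continuous_finsetProd _ fun j _ => ?_)
      exact Continuous.rpow_const (by fun_prop) fun x => .inr (hγ j).le)
  refine h1.congr (ae_of_all _ fun x => ?_)
  simp only [hw]; ring

theorem tendsto_polynomial_mul_weight (hγ : ∀ j, 0 < γ j)
    (hw : ∀ x : ℝ, w x = Real.exp (-x ^ 2) * ∏ j, |x - t j| ^ γ j) (f : ℝ[X]) :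
    Filter.Tendsto (fun x => f.eval x * w x) (Filter.cocompact ℝ) (nhds 0) := by
  have h1 := ((SubGaussianGrowth.polynomial f).mul
    (SubGaussianGrowth.weight_factor (t := t) hγ Finset.univ)).tendsto_zero
  refine h1.congr fun x => ?_
  simp only [hw]; ring

theorem integrable_polynomial_mul_weight_div (hγ : ∀ j, 0 < γ j)
    (hw : ∀ x : ℝ, w x = Real.exp (-x ^ 2) * ∏ j, |x - t j| ^ γ j) (f : ℝ[X]) (j : Fin N) :
    Integrable fun x => f.eval x * w x / (x - t j) := by
  have e : ∀ x, w x = Real.exp (-x ^ 2) * (∏ i ∈ Finset.univ.erase j, |x - t i| ^ γ i) *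
      |x - t j| ^ γ j := fun x => by
    rw [hw, mul_assoc, Finset.prod_erase_mul _ _ (Finset.mem_univ j)]
  have h1 := integrable_mul_abs_rpow_div (t := t j) (hγ j)
    (ψ := fun x => f.eval x * (Real.exp (-x ^ 2) * ∏ i ∈ Finset.univ.erase j, |x - t i| ^ γ i)) (by
      refine f.continuous.mul (Continuous.mul (by fun_prop) (continuous_finsetProd _ fun i _ => ?_))
      exact Continuous.rpow_const (by fun_prop) fun x => .inr (hγ i).le) (by
      refine (integrable_polynomial_mul_weight hγ hw f).congr (ae_of_all _ fun x => ?_)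
      simp only [e]; ring)
  refine h1.congr (ae_of_all _ fun x => ?_)
  simp only [e]; ring

theorem hasDerivAt_weight
    (hw : ∀ x : ℝ, w x = Real.exp (-x ^ 2) * ∏ j, |x - t j| ^ γ j) {x : ℝ} (hx : x ∉ Set.range t) :
    HasDerivAt w (-2 * x * w x + ∑ j, γ j * (w x / (x - t j))) x := by
  have h1 : HasDerivAt (fun y : ℝ => Real.exp (-y ^ 2)) (Real.exp (-x ^ 2) * (-2 * x)) x := by
    have h0 : HasDerivAt (fun y : ℝ => -y ^ 2) (-2 * x) x := by
      simpa using (hasDerivAt_pow 2 x).fun_neg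
    exact h0.exp
  have h2 := HasDerivAt.fun_finsetProd (u := Finset.univ) fun j _ =>
    hasDerivAt_abs_sub_rpow (γ := γ j) fun h => hx ⟨j, h.symm⟩
  rw [funext hw]
  refine (h1.mul h2).congr_deriv ?_
  simp only [smul_eq_mul]
  rw [Finset.mul_sum]
  congr 1
  · ring
  · refine Finset.sum_congr rfl fun j _ => ?_
    rw [← Finset.prod_erase_mul _ _ (Finset.mem_univ j)]
    ring

end Weight

section Stieltjes

variable {w : ℝ → ℝ} {z : ℂ}

theorem sub_ofReal_ne_zero (hz : z.im ≠ 0) (y : ℝ) : z - (y : ℂ) ≠ 0 := fun h =>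
  hz (by simpa using congrArg Complex.im h)

theorem norm_inv_sub_ofReal_le (hz : z.im ≠ 0) (y : ℝ) : ‖(z - (y : ℂ))⁻¹‖ ≤ |z.im|⁻¹ := by
  rw [norm_inv]
  refine inv_anti₀ (abs_pos.2 hz) ?_
  simpa using Complex.abs_im_le_norm (z - (y : ℂ))

theorem continuous_inv_sub_ofReal (hz : z.im ≠ 0) : Continuous fun y : ℝ => (z - (y : ℂ))⁻¹ :=
  Continuous.inv₀ (by fun_prop) (sub_ofReal_ne_zero hz)

theorem integrable_ofReal_mul_inv_pow (hz : z.im ≠ 0) {g : ℝ → ℝ} (hg : Integrable g) (k : ℕ) :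
    Integrable fun y => (g y : ℂ) * ((z - (y : ℂ))⁻¹) ^ k := by
  refine hg.ofReal.mul_bdd (c := |z.im|⁻¹ ^ k)
    ((continuous_inv_sub_ofReal hz).pow k).aestronglyMeasurable (ae_of_all _ fun y => ?_)
  rw [norm_pow]
  gcongr
  exact norm_inv_sub_ofReal_le hz y

/-- The functional `f ↦ ∫ f(y) w(y) (z - y)⁻ᵏ dy` on polynomials. -/
noncomputable def cauchyFunctional (w : ℝ → ℝ) (hw : ∀ f : ℝ[X], Integrable fun x => f.eval x * w x)
    (z : ℂ) (hz : z.im ≠ 0) (k : ℕ) : ℝ[X] →ₗ[ℝ] ℂ where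
  toFun f := ∫ y : ℝ, ((f.eval y * w y : ℝ) : ℂ) * ((z - (y : ℂ))⁻¹) ^ k
  map_add' f g := by
    rw [← integral_add (integrable_ofReal_mul_inv_pow hz (hw f) k)
      (integrable_ofReal_mul_inv_pow hz (hw g) k)]
    congr 1; ext y; simp; ring
  map_smul' c f := by
    rw [← integral_smul]
    congr 1; ext y; simp; ring

theorem cauchyFunctional_X_mul (hw : ∀ f : ℝ[X], Integrable fun x => f.eval x * w x)
    (hz : z.im ≠ 0) (k : ℕ) (f : ℝ[X]) :
    cauchyFunctional w hw z hz (k + 1) (X * f) =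
      z * cauchyFunctional w hw z hz (k + 1) f - cauchyFunctional w hw z hz k f := by
  simp only [cauchyFunctional, LinearMap.coe_mk, AddHom.coe_mk]
  rw [← integral_const_mul, ← integral_sub
    ((integrable_ofReal_mul_inv_pow hz (hw f) (k + 1)).const_mul z)
    (integrable_ofReal_mul_inv_pow hz (hw f) k)]
  congr 1; ext y
  have := mul_inv_cancel₀ (sub_ofReal_ne_zero hz y)
  simp only [eval_mul, eval_X, Complex.ofReal_mul]
  linear_combination (-(f.eval y : ℝ) * w y * ((z - (y : ℂ))⁻¹) ^ k) * this

theorem integral_eq_zero_of_hasDerivAt_off_countable {u u' : ℝ → ℂ} {s : Set ℝ} (hs : s.Countable)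
    (hc : Continuous u) (hd : ∀ x ∉ s, HasDerivAt u (u' x) x) (hi : Integrable u')
    (h0 : Filter.Tendsto u (Filter.cocompact ℝ) (nhds 0)) : ∫ x, u' x = 0 := by
  have h1 := intervalIntegral_tendsto_integral hi Filter.tendsto_neg_atTop_atBot Filter.tendsto_id
  have h2 : ∀ a : ℝ, ∫ x in -a..id a, u' x = u a - u (-a) := fun a =>
    integral_eq_of_hasDerivAt_off_countable u u' hs hc.continuousOn (fun x hx => hd x hx.2)
      hi.intervalIntegrable
  simp only [h2] at h1
  rw [cocompact_eq_atBot_atTop] at h0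
  have h3 := (h0.mono_left le_sup_right).sub
    ((h0.mono_left le_sup_left).comp Filter.tendsto_neg_atTop_atBot)
  rw [sub_zero] at h3
  exact tendsto_nhds_unique h1 h3

theorem sum_integral_div_eq {N : ℕ} {t γ : Fin N → ℝ} (hγ : ∀ j, 0 < γ j)
    (hw : ∀ x : ℝ, w x = Real.exp (-x ^ 2) * ∏ j, |x - t j| ^ γ j)
    (hi : ∀ f : ℝ[X], Integrable fun x => f.eval x * w x) (hz : z.im ≠ 0) (f : ℝ[X]) :
    ∑ j, (γ j : ℂ) * ∫ y : ℝ, ((f.eval y * w y : ℝ) : ℂ) / (((y : ℂ) - (t j : ℂ)) * (z - (y : ℂ)))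
      = 2 * z * cauchyFunctional w hi z hz 1 f - cauchyFunctional w hi z hz 1 (derivative f)
        - cauchyFunctional w hi z hz 2 f - 2 * cauchyFunctional w hi z hz 0 f := by
  have hiS : ∀ (g : ℝ[X]) k, Integrable fun y => ((g.eval y * w y : ℝ) : ℂ) * ((z - (y : ℂ))⁻¹) ^ k :=
    fun g k => integrable_ofReal_mul_inv_pow hz (hi g) k
  have hiD : ∀ j, Integrable fun y =>
      ((f.eval y * w y / (y - t j) : ℝ) : ℂ) * ((z - (y : ℂ))⁻¹) ^ 1 :=
    fun j => integrable_ofReal_mul_inv_pow hz (integrable_polynomial_mul_weight_div hγ hw f j) 1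
  set u' : ℝ → ℂ := fun y =>
    ((f.derivative.eval y * w y : ℝ) : ℂ) * ((z - (y : ℂ))⁻¹) ^ 1
      + ((f.eval y * w y : ℝ) : ℂ) * ((z - (y : ℂ))⁻¹) ^ 2
      - 2 * ((((X * f).eval y * w y : ℝ) : ℂ) * ((z - (y : ℂ))⁻¹) ^ 1)
      + ∑ j, (γ j : ℂ) * (((f.eval y * w y / (y - t j) : ℝ) : ℂ) * ((z - (y : ℂ))⁻¹) ^ 1) with hu'
  have hs : Integrable fun y => ∑ j, (γ j : ℂ) *
      (((f.eval y * w y / (y - t j) : ℝ) : ℂ) * ((z - (y : ℂ))⁻¹) ^ 1) :=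
    integrable_finsetSum _ fun j _ => (hiD j).const_mul _
  have hi12 : Integrable fun y => ((f.derivative.eval y * w y : ℝ) : ℂ) * ((z - (y : ℂ))⁻¹) ^ 1
      + ((f.eval y * w y : ℝ) : ℂ) * ((z - (y : ℂ))⁻¹) ^ 2 := (hiS _ 1).add (hiS _ 2)
  have hi123 : Integrable fun y => ((f.derivative.eval y * w y : ℝ) : ℂ) * ((z - (y : ℂ))⁻¹) ^ 1
      + ((f.eval y * w y : ℝ) : ℂ) * ((z - (y : ℂ))⁻¹) ^ 2
      - 2 * ((((X * f).eval y * w y : ℝ) : ℂ) * ((z - (y : ℂ))⁻¹) ^ 1) :=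
    hi12.sub ((hiS _ 1).const_mul 2)
  have h0 : ∫ y, u' y = 0 := by
    refine integral_eq_zero_of_hasDerivAt_off_countable
      (u := fun y => ((f.eval y * w y : ℝ) : ℂ) * (z - (y : ℂ))⁻¹) (s := Set.range t)
      (Set.countable_range t) ?_ ?_ ?_ ?_
    · exact (Complex.continuous_ofReal.comp (f.continuous.mul (continuous_weight hγ hw))).mul
        (continuous_inv_sub_ofReal hz)
    · intro x hx
      have h1 := ((f.hasDerivAt x).mul (hasDerivAt_weight hw hx)).ofReal_comp
      have h2 := ((Complex.ofRealCLM.hasDerivAt (x := x)).const_sub z).inv (sub_ofReal_ne_zero hz x)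
      refine (h1.mul h2).congr_deriv ?_
      simp only [hu', Complex.ofRealCLM_apply, Pi.mul_apply, Complex.ofReal_mul, Complex.ofReal_add,
        Complex.ofReal_sum, Complex.ofReal_div, eval_mul, eval_X, Complex.ofReal_one,
        Complex.ofReal_neg, Complex.ofReal_ofNat, Complex.ofReal_sub, Pi.inv_apply]
      have e : ∑ j, (γ j : ℂ) * (((f.eval x : ℝ) : ℂ) * w x / (x - t j) * ((z - (x : ℂ))⁻¹) ^ 1) =
          ((f.eval x : ℝ) : ℂ) * (z - (x : ℂ))⁻¹ * ∑ j, (γ j : ℂ) * (w x / (x - t j)) := by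
        rw [Finset.mul_sum]
        exact Finset.sum_congr rfl fun j _ => by ring
      rw [e, div_eq_mul_inv (- -1), ← inv_pow]
      ring
    · exact hi123.add hs
    · have h1 := ((Complex.continuous_ofReal.tendsto 0).comp
        (tendsto_polynomial_mul_weight hγ hw f)).norm
      simp only [Complex.ofReal_zero, norm_zero] at h1
      refine squeeze_zero_norm (fun y => ?_) (by simpa using h1.mul_const |z.im|⁻¹)
      rw [norm_mul]
      simpa using mul_le_mul_of_nonneg_left (norm_inv_sub_ofReal_le hz y)
        (norm_nonneg ((f.eval y * w y : ℝ) : ℂ))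
  have hX := cauchyFunctional_X_mul hi hz 0 f
  simp only [hu'] at h0
  rw [integral_add hi123 hs, integral_sub hi12 ((hiS _ 1).const_mul 2),
    integral_add (hiS _ 1) (hiS _ 2), integral_const_mul,
    integral_finsetSum _ fun j _ => (hiD j).const_mul _] at h0
  simp only [integral_const_mul] at h0
  have e : ∀ j, ∫ y : ℝ, ((f.eval y * w y : ℝ) : ℂ) / (((y : ℂ) - (t j : ℂ)) * (z - (y : ℂ))) =
      ∫ y : ℝ, ((f.eval y * w y / (y - t j) : ℝ) : ℂ) * ((z - (y : ℂ))⁻¹) ^ 1 := fun j => by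
    congr 1; ext y
    push_cast
    rw [pow_one, ← div_eq_mul_inv, div_div]
  simp only [e]
  change cauchyFunctional w hi z hz 1 (derivative f) + cauchyFunctional w hi z hz 2 f
    - 2 * cauchyFunctional w hi z hz 1 (X * f) + _ = 0 at h0
  rw [hX] at h0
  linear_combination h0

end Stieltjes

theorem sum_rule_S2'
    (N : ℕ) (hN : 1 ≤ N)
    (t γ : Fin N → ℝ) (ht : Function.Injective t) (hγ : ∀ j, 0 < γ j)
    (w : ℝ → ℝ) (hw : ∀ x : ℝ, w x = Real.exp (-x ^ 2) * ∏ j, |x - t j| ^ γ j)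
    (P : ℕ → Polynomial ℝ)
    (hPmonic : ∀ n, (P n).Monic) (hPdeg : ∀ n, (P n).natDegree = n)
    (horth : ∀ m n, m ≠ n → ∫ x : ℝ, (P m).eval x * (P n).eval x * w x = 0)
    (h : ℕ → ℝ) (hh : ∀ n, h n = ∫ x : ℝ, ((P n).eval x) ^ 2 * w x)
    (hhpos : ∀ n, 0 < h n)
    (β : ℕ → ℝ) (hβ0 : β 0 = 0) (hβ : ∀ n, β (n + 1) = h (n + 1) / h n)
    (α : ℕ → ℝ) (hα : ∀ n, α n = (∫ x : ℝ, x * ((P n).eval x) ^ 2 * w x) / h n)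
    (A B : ℕ → ℂ → ℂ)
    (hA : ∀ n (z : ℂ), A n z = 2 + ∑ j, ((γ j / h n : ℝ) : ℂ) *
      ∫ y : ℝ, (Complex.ofReal ((P n).eval y)) ^ 2 * (w y : ℂ) / (((y : ℂ) - (t j : ℂ)) * (z - (y : ℂ))))
    (hB0 : ∀ z : ℂ, B 0 z = 0)
    (hB : ∀ n (z : ℂ), B (n + 1) z = ∑ j, ((γ j / h n : ℝ) : ℂ) *
      ∫ y : ℝ, (Complex.ofReal ((P (n + 1)).eval y)) * (Complex.ofReal ((P n).eval y)) * (w y : ℂ) / (((y : ℂ) - (t j : ℂ)) * (z - (y : ℂ))))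
    (n : ℕ) (z : ℂ) (hz : z.im ≠ 0) :
    (B n z) ^ 2 + 2 * z * B n z + ∑ i ∈ Finset.range n, A i z = (β n : ℂ) * A n z * A (n - 1) z := by
  have hi := integrable_polynomial_mul_weight hγ hw
  rcases n with _ | n
  · simp [hB0, hβ0]
  have hL0 : ∀ f, cauchyFunctional w hi z hz 0 f = ((∫ y, f.eval y * w y : ℝ) : ℂ) := fun f => by
    rw [← integral_complex_ofReal]
    simp [cauchyFunctional]
  have hne : ∀ n, (h n : ℂ) ≠ 0 := fun n => by exact_mod_cast (hhpos n).ne'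
  have ho : ∀ m n, m ≠ n → cauchyFunctional w hi z hz 0 (P m * P n) = 0 := fun m n hmn => by
    rw [hL0]
    simpa using horth m n hmn
  have hnorm : ∀ n, cauchyFunctional w hi z hz 0 (P n * P n) = h n := fun n => by
    rw [hL0, hh]
    simp [sq]
  have hsum := fun f => sum_integral_div_eq hγ hw hi hz f
  have hscale : ∀ (n : ℕ) (c : Fin N → ℂ), (h n : ℂ) * ∑ j, ((γ j / h n : ℝ) : ℂ) * c j =
      ∑ j, (γ j : ℂ) * c j := fun n c => by
    rw [Finset.mul_sum]
    refine Finset.sum_congr rfl fun j _ => ?_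
    have := hne n
    push_cast
    field_simp
  have hfinal := sum_rule_of_functionals hPmonic hPdeg ho hnorm hhpos (z := z)
    (S := cauchyFunctional w hi z hz 1) (T := -cauchyFunctional w hi z hz 2)
    (fun f => cauchyFunctional_X_mul hi hz 0 f)
    (fun f => by
      simp only [LinearMap.neg_apply, cauchyFunctional_X_mul hi hz 1 f]
      ring)
    (fun n => A n z) (fun n => B n z)
    (fun n => by
      have h1 := hsum (P n * P n)
      rw [hnorm] at h1
      rw [hA, mul_add, hscale, LinearMap.neg_apply]
      simp only [eval_mul, Complex.ofReal_mul] at h1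
      simp only [sq]
      linear_combination h1)
    (fun n => by
      have h1 := hsum (P (n + 1) * P n)
      rw [ho _ _ (by omega)] at h1
      rw [hB, hscale, LinearMap.neg_apply]
      simp only [eval_mul, Complex.ofReal_mul] at h1
      linear_combination h1) n
  rw [hβ]
  simpa using hfinal
end
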